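/- Every standard dyadic partition of [0,1] with at least two subintervals contains two consecutive subintervals that are the left and right halves of a standard dyadic interval; that is, there exist an index i and nonnegative integers a, b with [x_{i−1}, x_i] = [2a/2^b, (2a+1)/2^b] and [x_i, x_{i+1}] = [(2a+1)/2^b, (2a+2)/2^b]. -/

import Mathlib

/-- `[p, q]` is a standard dyadic interval: `p = a / 2 ^ b`, `q = (a + 1) / 2 ^ b` for
nonnegative integers `a`, `b`, and `[p, q] ⊆ [0, 1]`. -/
def IsStdDyadicInterval (p q : ℝ) : Prop :=
  ∃ (a b : ℕ), p = (a : ℝ) / 2 ^ b ∧ q = ((a : ℝ) + 1) / 2 ^ b ∧ q ≤ 1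

/-- `x 0 = 0 < x 1 < ⋯ < x n = 1` is a standard dyadic partition of `[0,1]`: every
subinterval `[x i, x (i+1)]` is a standard dyadic interval. -/
def IsStdDyadicPartition (n : ℕ) (x : ℕ → ℝ) : Prop :=
  0 < n ∧ x 0 = 0 ∧ x n = 1 ∧ ∀ i < n, IsStdDyadicInterval (x i) (x (i + 1))

theorem dyadic_odd_aux (m c b B : ℕ) (hb : b ≤ B)
    (h : (m : ℝ) / 2 ^ b = ((2 * c + 1 : ℕ) : ℝ) / 2 ^ B) : b = B ∧ m = 2 * c + 1 := by
  obtain ⟨d, rfl⟩ := Nat.exists_eq_add_of_le hb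
  have h2 : (m : ℝ) * 2 ^ d = ((2 * c + 1 : ℕ) : ℝ) := by
    rw [pow_add, div_eq_div_iff (by positivity) (by positivity)] at h
    have : (2 : ℝ) ^ b ≠ 0 := by positivity
    apply mul_right_cancel₀ this
    linarith
  have h3 : m * 2 ^ d = 2 * c + 1 := by exact_mod_cast h2
  cases d with
  | zero => simpa using h3
  | succ d =>
    exfalso
    rw [pow_succ, ← mul_assoc] at h3
    omega

/-- Every standard dyadic partition of `[0,1]` with at least two subintervals contains two
consecutive subintervals that are the left and right halves of a standard dyadic interval. -/
theorem stdDyadicPartition_exists_caret (n : ℕ) (x : ℕ → ℝ)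
    (hx : IsStdDyadicPartition n x) (hn : 2 ≤ n) :
    ∃ (i a b : ℕ), 1 ≤ i ∧ i + 1 ≤ n ∧
      x (i - 1) = ((2 * a : ℕ) : ℝ) / 2 ^ b ∧
      x i = ((2 * a + 1 : ℕ) : ℝ) / 2 ^ b ∧
      x (i + 1) = ((2 * a + 2 : ℕ) : ℝ) / 2 ^ b := by
  obtain ⟨hn0, h0, h1, h⟩ := hx
  have h' : ∀ i, ∃ a b : ℕ, i < n →
      x i = (a : ℝ) / 2 ^ b ∧ x (i + 1) = ((a : ℝ) + 1) / 2 ^ b ∧ x (i + 1) ≤ 1 := by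
    intro i
    by_cases hi : i < n
    · obtain ⟨a, b, hab⟩ := h i hi
      exact ⟨a, b, fun _ => hab⟩
    · exact ⟨0, 0, fun h => absurd h hi⟩
  choose a b hab using h'
  obtain ⟨k, hk, hmax⟩ := Finset.exists_max_image (Finset.range n) b ⟨0, by simpa using hn0⟩
  simp only [Finset.mem_range] at hk hmax
  obtain ⟨hk1, hk2, hk3⟩ := hab k hk
  have hB : b k ≠ 0 := by
    intro hB
    have e0 : b 0 = 0 := by have := hmax 0 hn0; omega
    have e1 : b 1 = 0 := by have := hmax 1 (by omega); omega
    obtain ⟨p1, p2, p3⟩ := hab 0 hn0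
    obtain ⟨q1, q2, q3⟩ := hab 1 (by omega)
    simp only [e0, e1, pow_zero, div_one, zero_add] at p1 p2 q1 q2
    linarith
  rcases Nat.even_or_odd' (a k) with ⟨c, hc | hc⟩
  · have hk2' : x (k + 1) = ((2 * c + 1 : ℕ) : ℝ) / 2 ^ b k := by
      rw [hk2, hc]; push_cast; rfl
    have hkn : k + 1 < n := by
      by_contra hcon
      have e : k + 1 = n := by omega
      have := dyadic_odd_aux 1 c 0 (b k) (by omega) (by rw [← hk2', e, h1]; simp)
      omega
    obtain ⟨p1, p2, p3⟩ := hab (k + 1) hkn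
    obtain ⟨e1, e2⟩ := dyadic_odd_aux _ c _ (b k) (hmax _ hkn) (by rw [← hk2', ← p1])
    refine ⟨k + 1, c, b k, by omega, by omega, ?_, hk2', ?_⟩
    · rw [Nat.add_sub_cancel, hk1, hc]
    · rw [p2, e1, e2]; push_cast; ring
  · have hk1' : x k = ((2 * c + 1 : ℕ) : ℝ) / 2 ^ b k := by rw [hk1, hc]
    obtain _ | j := k
    · have := dyadic_odd_aux 0 c 0 (b 0) (by omega) (by rw [← hk1', h0]; simp)
      omega
    · obtain ⟨p1, p2, p3⟩ := hab j (by omega)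
      obtain ⟨e1, e2⟩ := dyadic_odd_aux (a j + 1) c _ _ (hmax j (by omega))
        (by rw [← hk1', p2]; push_cast; rfl)
      refine ⟨j + 1, c, b (j + 1), by omega, by omega, ?_, hk1', ?_⟩
      · rw [Nat.add_sub_cancel, p1, e1, show a j = 2 * c by omega]
      · rw [hk2, hc]; push_cast; ring
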